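/- arXiv:1506.08742 — 3 statements merged into one kernel-verified Lean document; each statement's English description precedes it below -/
import Mathlib

section
/- Contour-integral representation of the one-step transfer functions: for all integers s, t ≥ 0, with the positively oriented circle {|u| = 2}: (a) −(1/(2πi))·∮_{|u|=2} [(1/π)·∫_{−1}^{1} J_{s,−1/2}(x)·J_{t,1/2}(u)·(1−x)^{−1/2}(1+x)^{1/2}/(x−u) dx] du = 1_{(s ≤ t)}; and (b) −(1/(2πi))·∮_{|u|=2} [(2/π)·∫_{−1}^{1} J_{s,1/2}(x)·J_{t,−1/2}(u)·(1−x)^{1/2}(1+x)^{1/2}/((x−u)(u−1)) dx] du = 2·1_{(s < t)}. -/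
open MeasureTheory Real

/-- Chebyshev polynomials of the second (`α = 1/2`) and third (`α = -1/2`) kind. -/
noncomputable def chebJ (α : ℝ) : ℕ → ℝ → ℝ
  | 0, _ => 1
  | 1, x => if α = 1 / 2 then 2 * x else 2 * x - 1
  | n + 2, x => 2 * x * chebJ α (n + 1) x - chebJ α n x

/-- Chebyshev polynomials of the second and third kind at complex arguments. -/
noncomputable def chebJC (α : ℝ) : ℕ → ℂ → ℂ
  | 0, _ => 1
  | 1, z => if α = 1 / 2 then 2 * z else 2 * z - 1
  | n + 2, z => 2 * z * chebJC α (n + 1) z - chebJC α n z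

lemma chebJ_one_half_succ (n : ℕ) (x : ℝ) :
    chebJ (1 / 2) (n + 1) x = chebJ (1 / 2) n x + chebJ (-(1 / 2)) (n + 1) x := by
  induction n using Nat.strong_induction_on with
  | _ n ih =>
    match n with
    | 0 => norm_num [chebJ]
    | 1 => norm_num [chebJ]; ring
    | n + 2 =>
      have h₀ := ih n (by lia)
      have h₁ := ih (n + 1) (by lia)
      have h₂ : chebJ (1 / 2) (n + 2 + 1) x =
        2 * x * chebJ (1 / 2) (n + 2) x - chebJ (1 / 2) (n + 1) x := rfl
      have h₃ : chebJ (-(1 / 2)) (n + 2 + 1) x =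
        2 * x * chebJ (-(1 / 2)) (n + 2) x - chebJ (-(1 / 2)) (n + 1) x := rfl
      have h₄ : chebJ (1 / 2) (n + 2) x =
        2 * x * chebJ (1 / 2) (n + 1) x - chebJ (1 / 2) n x := rfl
      rw [h₂, h₃]
      linear_combination 2 * x * h₁ - h₀ - h₄

lemma chebJ_neg_one_half_succ (n : ℕ) (x : ℝ) :
    chebJ (-(1 / 2)) (n + 1) x = chebJ (-(1 / 2)) n x + 2 * (x - 1) * chebJ (1 / 2) n x := by
  induction n using Nat.strong_induction_on with
  | _ n ih =>
    match n with
    | 0 => norm_num [chebJ]; ring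
    | 1 => norm_num [chebJ]; ring
    | n + 2 =>
      have h₀ := ih n (by lia)
      have h₁ := ih (n + 1) (by lia)
      have h₂ : chebJ (-(1 / 2)) (n + 2 + 1) x =
        2 * x * chebJ (-(1 / 2)) (n + 2) x - chebJ (-(1 / 2)) (n + 1) x := rfl
      have h₃ : chebJ (-(1 / 2)) (n + 2) x =
        2 * x * chebJ (-(1 / 2)) (n + 1) x - chebJ (-(1 / 2)) n x := rfl
      have h₄ : chebJ (1 / 2) (n + 2) x =
        2 * x * chebJ (1 / 2) (n + 1) x - chebJ (1 / 2) n x := rfl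
      rw [h₂, h₄]
      linear_combination 2 * x * h₁ - h₀ - h₃

lemma chebJ_neg_one_half_eq_one_add_sum (n : ℕ) (x : ℝ) :
    chebJ (-(1 / 2)) n x =
      1 + (x - 1) * (2 * ∑ k ∈ Finset.range n, chebJ (1 / 2) k x) := by
  induction n with
  | zero => simp [chebJ]
  | succ n ih => rw [chebJ_neg_one_half_succ, ih, Finset.sum_range_succ]; ring

lemma ofReal_chebJ (α : ℝ) (n : ℕ) (x : ℝ) : (chebJ α n x : ℂ) = chebJC α n x := by
  induction n using Nat.strong_induction_on with
  | _ n ih =>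
    match n with
    | 0 => simp [chebJ, chebJC]
    | 1 => simp only [chebJ, chebJC]; split_ifs <;> push_cast <;> rfl
    | n + 2 => simp [chebJ, chebJC, ih n (by lia), ih (n + 1) (by lia)]

lemma differentiable_chebJC (α : ℝ) (n : ℕ) : Differentiable ℂ (chebJC α n) := by
  induction n using Nat.strong_induction_on with
  | _ n ih =>
    match n with
    | 0 => exact differentiable_const 1
    | 1 =>
      change Differentiable ℂ fun z => if α = 1 / 2 then 2 * z else 2 * z - 1
      split_ifs <;> fun_prop
    | n + 2 =>
      have h₀ := ih n (by lia)
      have h₁ := ih (n + 1) (by lia)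
      change Differentiable ℂ fun z => 2 * z * chebJC α (n + 1) z - chebJC α n z
      fun_prop

@[fun_prop]
lemma continuous_chebJ (α : ℝ) (n : ℕ) : Continuous (chebJ α n) := by
  have h : chebJ α n = fun x : ℝ => (chebJC α n x).re := by
    ext x; rw [← ofReal_chebJ, Complex.ofReal_re]
  rw [h]
  have := (differentiable_chebJC α n).continuous
  fun_prop

lemma chebJ_one_half_cos_mul_sin (n : ℕ) (θ : ℝ) :
    chebJ (1 / 2) n (cos θ) * sin θ = sin ((n + 1) * θ) := by
  induction n using Nat.strong_induction_on with
  | _ n ih =>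
    match n with
    | 0 => simp [chebJ]
    | 1 => norm_num [chebJ, sin_two_mul]; ring
    | n + 2 =>
      have h₀ := ih n (by lia)
      have h₁ := ih (n + 1) (by lia)
      have h := sin_add ((n + 2) * θ) θ
      have h' := sin_sub ((n + 2) * θ) θ
      rw [show (n + 2) * θ + θ = (n + 3) * θ by ring] at h
      rw [show (n + 2) * θ - θ = (n + 1) * θ by ring] at h'
      rw [chebJ]
      push_cast at *
      ring_nf at *
      linear_combination 2 * cos θ * h₁ - h₀ - h - h'

lemma chebJ_neg_one_half_cos_mul_cos (n : ℕ) (θ : ℝ) :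
    chebJ (-(1 / 2)) n (cos θ) * cos (θ / 2) = cos ((n + 1 / 2) * θ) := by
  induction n using Nat.strong_induction_on with
  | _ n ih =>
    match n with
    | 0 => simp [chebJ]; ring_nf
    | 1 =>
      have h := cos_add θ (θ / 2)
      have h' := cos_sub θ (θ / 2)
      rw [show θ - θ / 2 = θ / 2 by ring] at h'
      have e : ((1 : ℕ) + 1 / 2 : ℝ) * θ = θ + θ / 2 := by push_cast; ring
      rw [e, h]
      norm_num [chebJ]
      linear_combination -h'
    | n + 2 =>
      have h₀ := ih n (by lia)
      have h₁ := ih (n + 1) (by lia)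
      have h := cos_add ((n + 1 + 1 / 2) * θ) θ
      have h' := cos_sub ((n + 1 + 1 / 2) * θ) θ
      rw [show (n + 1 + 1 / 2) * θ + θ = (n + 2 + 1 / 2) * θ by ring] at h
      rw [show (n + 1 + 1 / 2) * θ - θ = (n + 1 / 2) * θ by ring] at h'
      rw [chebJ]
      push_cast at *
      linear_combination 2 * cos θ * h₁ - h₀ - h - h'

open Polynomial.Chebyshev (measureT integral_measureT integrable_measureT
  integral_measureT_eq_integral_cos intervalIntegrable_sqrt_one_sub_sq_inv)

lemma integral_cos_int_mul (n : ℤ) :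
    ∫ θ in (0 : ℝ)..π, cos (n * θ) = if n = 0 then π else 0 := by
  split_ifs with h
  · simp [h]
  · rw [intervalIntegral.integral_comp_mul_left _ (Int.cast_ne_zero.mpr h)]
    simp

lemma integral_chebJ_neg_one_half_mul_self (s t : ℕ) :
    ∫ x, chebJ (-(1 / 2)) s x * chebJ (-(1 / 2)) t x * (1 + x) ∂measureT =
      if s = t then π else 0 := by
  have h (θ : ℝ) : chebJ (-(1 / 2)) s (cos θ) * chebJ (-(1 / 2)) t (cos θ) * (1 + cos θ) =
      cos (((s + t + 1 : ℤ) : ℝ) * θ) + cos (((s - t : ℤ) : ℝ) * θ) := by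
    have e : 1 + cos θ = 2 * cos (θ / 2) * cos (θ / 2) := by
      have := cos_sq (θ / 2)
      rw [mul_div_cancel₀ θ (two_ne_zero)] at this
      linarith
    have ha := cos_add ((s + 1 / 2) * θ) ((t + 1 / 2) * θ)
    have hs := cos_sub ((s + 1 / 2) * θ) ((t + 1 / 2) * θ)
    rw [show ((s + t + 1 : ℤ) : ℝ) * θ = (s + 1 / 2) * θ + (t + 1 / 2) * θ by push_cast; ring,
      show ((s - t : ℤ) : ℝ) * θ = (s + 1 / 2) * θ - (t + 1 / 2) * θ by push_cast; ring, ha, hs,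
      ← chebJ_neg_one_half_cos_mul_cos, ← chebJ_neg_one_half_cos_mul_cos, e]
    ring
  simp_rw [integral_measureT_eq_integral_cos, h]
  rw [intervalIntegral.integral_add (Continuous.intervalIntegrable (by fun_prop) _ _)
    (Continuous.intervalIntegrable (by fun_prop) _ _), integral_cos_int_mul, integral_cos_int_mul,
    if_neg (by lia), zero_add]
  exact if_congr (by lia) rfl rfl

lemma integral_chebJ_one_half_mul_self (s t : ℕ) :
    ∫ x, chebJ (1 / 2) s x * chebJ (1 / 2) t x * (1 - x ^ 2) ∂measureT =
      if s = t then π / 2 else 0 := by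
  have h (θ : ℝ) : chebJ (1 / 2) s (cos θ) * chebJ (1 / 2) t (cos θ) * (1 - cos θ ^ 2) =
      (cos (((s - t : ℤ) : ℝ) * θ) - cos (((s + t + 2 : ℤ) : ℝ) * θ)) / 2 := by
    have ha := cos_add ((s + 1) * θ) ((t + 1) * θ)
    have hs := cos_sub ((s + 1) * θ) ((t + 1) * θ)
    rw [show ((s + t + 2 : ℤ) : ℝ) * θ = (s + 1) * θ + (t + 1) * θ by push_cast; ring,
      show ((s - t : ℤ) : ℝ) * θ = (s + 1) * θ - (t + 1) * θ by push_cast; ring, ha, hs,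
      ← chebJ_one_half_cos_mul_sin, ← chebJ_one_half_cos_mul_sin, ← sin_sq]
    ring
  simp_rw [integral_measureT_eq_integral_cos, h]
  rw [intervalIntegral.integral_div,
    intervalIntegral.integral_sub (Continuous.intervalIntegrable (by fun_prop) _ _)
    (Continuous.intervalIntegrable (by fun_prop) _ _), integral_cos_int_mul, integral_cos_int_mul,
    if_neg (show ¬ (s + t + 2 : ℤ) = 0 by lia), sub_zero]
  by_cases hst : s = t <;> simp [hst, sub_eq_zero]

lemma integral_chebJ_neg_one_half_mul_chebJ_one_half (s t : ℕ) :
    ∫ x, chebJ (-(1 / 2)) s x * chebJ (1 / 2) t x * (1 + x) ∂measureT =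
      if s ≤ t then π else 0 := by
  induction t with
  | zero =>
    have h := integral_chebJ_neg_one_half_mul_self s 0
    simpa [chebJ] using h
  | succ t ih =>
    have h (x : ℝ) : chebJ (-(1 / 2)) s x * chebJ (1 / 2) (t + 1) x * (1 + x) =
        chebJ (-(1 / 2)) s x * chebJ (1 / 2) t x * (1 + x) +
          chebJ (-(1 / 2)) s x * chebJ (-(1 / 2)) (t + 1) x * (1 + x) := by
      rw [chebJ_one_half_succ]; ring
    simp_rw [h]
    rw [integral_add (integrable_measureT (by fun_prop)) (integrable_measureT (by fun_prop)), ih,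
      integral_chebJ_neg_one_half_mul_self]
    split_ifs <;> first | lia | simp

lemma integral_chebJ_one_half_mul_sum (s t : ℕ) :
    ∫ x, chebJ (1 / 2) s x * (2 * ∑ k ∈ Finset.range t, chebJ (1 / 2) k x) *
      (1 - x ^ 2) ∂measureT = if s < t then π else 0 := by
  have h (x : ℝ) : chebJ (1 / 2) s x * (2 * ∑ k ∈ Finset.range t, chebJ (1 / 2) k x) *
      (1 - x ^ 2) =
      2 * ∑ k ∈ Finset.range t, chebJ (1 / 2) s x * chebJ (1 / 2) k x * (1 - x ^ 2) := by
    rw [← Finset.sum_mul, ← Finset.mul_sum]; ring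
  simp_rw [h]
  rw [integral_const_mul, integral_finsetSum _ fun k _ => integrable_measureT (by fun_prop)]
  simp_rw [integral_chebJ_one_half_mul_self]
  simp [Finset.sum_ite_eq]
  split_ifs <;> ring

lemma circleIntegral_intervalIntegral_swap {w : ℝ → ℂ} {F : ℂ → ℂ}
    (hw : IntervalIntegrable w volume (-1) 1) (hF : ContinuousOn F (Metric.sphere 0 2)) :
    (∮ u in C(0, 2), ∫ x in (-1 : ℝ)..1, w x * (F u / ((x : ℂ) - u))) =
      ∫ x in (-1 : ℝ)..1, w x * ∮ u in C(0, 2), F u / ((x : ℂ) - u) := by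
  set G : ℝ → ℂ := fun θ => deriv (circleMap 0 2) θ * F (circleMap 0 2 θ) with hG
  have hGc : Continuous G := by
    simp only [hG, deriv_circleMap]
    have : Continuous fun θ => F (circleMap 0 2 θ) :=
      hF.comp_continuous (continuous_circleMap 0 2) fun θ => circleMap_mem_sphere 0 (by norm_num) θ
    exact ((continuous_circleMap 0 2).mul continuous_const).mul this
  have hl (θ : ℝ) : deriv (circleMap 0 2) θ • ∫ x in (-1 : ℝ)..1,
      w x * (F (circleMap 0 2 θ) / ((x : ℂ) - circleMap 0 2 θ)) =
      ∫ x in (-1 : ℝ)..1, ((x : ℂ) - circleMap 0 2 θ)⁻¹ * (G θ * w x) := by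
    rw [smul_eq_mul, ← intervalIntegral.integral_const_mul]
    refine intervalIntegral.integral_congr fun x _ => ?_
    simp only [hG, div_eq_mul_inv]; ring
  have hr (x : ℝ) : w x * ∮ u in C(0, 2), F u / ((x : ℂ) - u) =
      ∫ θ in (0 : ℝ)..2 * π, ((x : ℂ) - circleMap 0 2 θ)⁻¹ * (G θ * w x) := by
    rw [circleIntegral, ← intervalIntegral.integral_const_mul]
    refine intervalIntegral.integral_congr fun θ _ => ?_
    simp only [hG, div_eq_mul_inv, smul_eq_mul]; ring
  rw [circleIntegral]
  simp_rw [hl, hr]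
  refine intervalIntegral_intervalIntegral_swap ?_
  rw [IntegrableOn, Measure.volume_eq_prod, ← Measure.prod_restrict]
  have hGi : Integrable G (volume.restrict (Set.uIoc 0 (2 * π))) :=
    intervalIntegrable_iff.mp (hGc.intervalIntegrable _ _)
  refine (hGi.mul_prod (intervalIntegrable_iff.mp hw)).bdd_mul (c := 1) ?_ ?_
  · exact Measurable.aestronglyMeasurable (by fun_prop)
  · rw [Measure.prod_restrict]
    refine ae_restrict_of_forall_mem (measurableSet_uIoc.prod measurableSet_uIoc) ?_
    rintro ⟨θ, x⟩ ⟨-, hx⟩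
    rw [Set.uIoc_of_le (by norm_num)] at hx
    rw [norm_inv]
    refine inv_le_one_of_one_le₀ ?_
    have h₁ : ‖circleMap 0 2 θ‖ = 2 := by simp
    have h₂ : ‖(x : ℂ)‖ ≤ 1 := by
      rw [Complex.norm_real, Real.norm_eq_abs, abs_le]; exact ⟨hx.1.le, hx.2⟩
    have h₃ := norm_sub_norm_le (circleMap 0 2 θ) (x : ℂ)
    rw [norm_sub_rev] at h₃
    dsimp only
    linarith

lemma circleIntegral_weighted_cauchy {g H : ℝ → ℝ} {F : ℂ → ℂ} (c : ℂ)
    (hg : ContinuousOn g (Set.Icc (-1) 1))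
    (hF : ContinuousOn F (Metric.sphere 0 2))
    (hH : ∀ x ∈ Set.Ioo (-1 : ℝ) 1,
      (∮ u in C(0, 2), F u / ((x : ℂ) - u)) = -(2 * π * Complex.I) * H x) :
    -(1 / (2 * (π : ℂ) * Complex.I)) * (∮ u in C(0, 2), c * ∫ x in (-1 : ℝ)..1,
        ((g x * √(1 - x ^ 2)⁻¹ : ℝ) : ℂ) * (F u / ((x : ℂ) - u))) =
      c * ((∫ x, g x * H x ∂measureT : ℝ) : ℂ) := by
  have hw : IntervalIntegrable (fun x => ((g x * √(1 - x ^ 2)⁻¹ : ℝ) : ℂ)) volume (-1) 1 :=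
    intervalIntegrable_iff.mpr (intervalIntegrable_iff.mp
      (intervalIntegrable_sqrt_one_sub_sq_inv.continuousOn_mul
        (by rwa [Set.uIcc_of_le (by norm_num)]))).ofReal
  have hpi : (2 * (π : ℂ) * Complex.I) ≠ 0 := Complex.two_pi_I_ne_zero
  rw [circleIntegral.integral_const_mul, circleIntegral_intervalIntegral_swap hw hF,
    integral_measureT, ← intervalIntegral.integral_ofReal]
  have key : ∫ x in (-1 : ℝ)..1, ((g x * √(1 - x ^ 2)⁻¹ : ℝ) : ℂ) *
        ∮ u in C(0, 2), F u / ((x : ℂ) - u) =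
      ∫ x in (-1 : ℝ)..1, -(2 * π * Complex.I) * ((g x * H x * √(1 - x ^ 2)⁻¹ : ℝ) : ℂ) := by
    refine intervalIntegral.integral_congr fun x hx => ?_
    rw [Set.uIcc_of_le (by norm_num)] at hx
    rcases eq_or_ne (x ^ 2) 1 with h | h
    · simp [h]
    · rw [hH x ⟨lt_of_le_of_ne hx.1 (by rintro rfl; norm_num at h),
        lt_of_le_of_ne hx.2 (by rintro rfl; norm_num at h)⟩]
      push_cast; ring
  rw [key, intervalIntegral.integral_const_mul]
  field_simp

lemma circleIntegral_div_sub_of_differentiable {F : ℂ → ℂ} (hF : Differentiable ℂ F) {w : ℂ}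
    (hw : w ∈ Metric.ball (0 : ℂ) 2) :
    (∮ u in C(0, 2), F u / (u - w)) = 2 * π * Complex.I * F w :=
  Complex.circleIntegral_div_sub_of_differentiable_on_off_countable Set.countable_empty hw
    hF.continuous.continuousOn fun z _ => hF z

lemma circleIntegral_div_sub_mul_sub {F : ℂ → ℂ} (hF : Differentiable ℂ F) {z w : ℂ}
    (hz : z ∈ Metric.ball (0 : ℂ) 2) (hw : w ∈ Metric.ball (0 : ℂ) 2) (hzw : z ≠ w) :
    (∮ u in C(0, 2), F u / (u - w) / (z - u)) =
      -(2 * π * Complex.I) * ((F z - F w) / (z - w)) := by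
  have hne {v : ℂ} (hv : v ∈ Metric.ball (0 : ℂ) 2) {u : ℂ} (hu : u ∈ Metric.sphere (0 : ℂ) 2) :
      u - v ≠ 0 := by
    rw [sub_ne_zero]; rintro rfl
    simp at hu hv; linarith
  have hi {v : ℂ} (hv : v ∈ Metric.ball (0 : ℂ) 2) :
      CircleIntegrable (fun u => F u / (u - v)) 0 2 :=
    ContinuousOn.circleIntegrable (by norm_num)
      (hF.continuous.continuousOn.div (by fun_prop) fun u hu => hne hv hu)
  have h : (∮ u in C(0, 2), F u / (u - w) / (z - u)) =
      ∮ u in C(0, 2), -(z - w)⁻¹ * (F u / (u - z) - F u / (u - w)) := by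
    refine circleIntegral.integral_congr (by norm_num) fun u hu => ?_
    have h₁ := hne hz hu
    have h₂ := hne hw hu
    have h₃ := sub_ne_zero.mpr hzw
    have h₄ : z - u ≠ 0 := by rw [← neg_sub]; exact neg_ne_zero.mpr h₁
    rw [← neg_sub u z]
    field_simp
    ring
  rw [h, circleIntegral.integral_const_mul, circleIntegral.integral_sub (hi hz) (hi hw),
    circleIntegral_div_sub_of_differentiable hF hz, circleIntegral_div_sub_of_differentiable hF hw]
  ring

lemma ofReal_mem_ball_zero_two {x : ℝ} (hx : x ∈ Set.Icc (-1 : ℝ) 1) :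
    (x : ℂ) ∈ Metric.ball (0 : ℂ) 2 := by
  rw [mem_ball_zero_iff, Complex.norm_real, Real.norm_eq_abs]
  exact (abs_le.mpr hx).trans_lt (by norm_num)

lemma rpow_neg_half_mul_rpow_half {x : ℝ} (hx : x ∈ Set.Icc (-1 : ℝ) 1) :
    (1 - x) ^ (-(1 : ℝ) / 2) * (1 + x) ^ ((1 : ℝ) / 2) = (1 + x) * √(1 - x ^ 2)⁻¹ := by
  have h₁ : 0 ≤ 1 - x := by linarith [hx.2]
  have h₂ : 0 ≤ 1 + x := by linarith [hx.1]
  rw [neg_div, rpow_neg h₁, ← sqrt_eq_rpow, ← sqrt_eq_rpow, sqrt_inv,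
    show 1 - x ^ 2 = (1 - x) * (1 + x) by ring, sqrt_mul h₁, mul_inv]
  nth_rewrite 2 [← mul_self_sqrt h₂]
  rcases eq_or_ne √(1 + x) 0 with h | h
  · simp [h]
  · field_simp

lemma rpow_half_mul_rpow_half {x : ℝ} (hx : x ∈ Set.Icc (-1 : ℝ) 1) :
    (1 - x) ^ ((1 : ℝ) / 2) * (1 + x) ^ ((1 : ℝ) / 2) = (1 - x ^ 2) * √(1 - x ^ 2)⁻¹ := by
  have h₁ : 0 ≤ 1 - x := by linarith [hx.2]
  have h₂ : 0 ≤ 1 - x ^ 2 := by nlinarith [hx.1, hx.2]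
  rw [← sqrt_eq_rpow, ← sqrt_eq_rpow, ← sqrt_mul h₁, sqrt_inv,
    show (1 - x) * (1 + x) = 1 - x ^ 2 by ring]
  nth_rewrite 2 [← mul_self_sqrt h₂]
  rcases eq_or_ne √(1 - x ^ 2) 0 with h | h
  · simp [h]
  · field_simp

/-- Contour-integral representation of the one-step transfer functions `φ_n(s,t)`. -/
theorem transfer_contour_representation (s t : ℕ) :
    (-(1 / (2 * (Real.pi : ℂ) * Complex.I)) *
        (∮ u in C(0, 2),
          (1 / (Real.pi : ℂ)) *
            ∫ x in (-1 : ℝ)..1,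
              ((chebJ (-(1 / 2)) s x * (1 - x) ^ (-(1 : ℝ) / 2) *
                  (1 + x) ^ ((1 : ℝ) / 2) : ℝ) : ℂ) *
                chebJC (1 / 2) t u / ((x : ℂ) - u))
      = (if s ≤ t then (1 : ℂ) else 0)) ∧
    (-(1 / (2 * (Real.pi : ℂ) * Complex.I)) *
        (∮ u in C(0, 2),
          (2 / (Real.pi : ℂ)) *
            ∫ x in (-1 : ℝ)..1,
              ((chebJ (1 / 2) s x * (1 - x) ^ ((1 : ℝ) / 2) *
                  (1 + x) ^ ((1 : ℝ) / 2) : ℝ) : ℂ) *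
                chebJC (-(1 / 2)) t u / (((x : ℂ) - u) * (u - 1)))
      = (if s < t then (2 : ℂ) else 0)) := by
  have hpi : (π : ℂ) ≠ 0 := Complex.ofReal_ne_zero.mpr pi_ne_zero
  constructor
  · have h (u : ℂ) : ∫ x in (-1 : ℝ)..1,
        ((chebJ (-(1 / 2)) s x * (1 - x) ^ (-(1 : ℝ) / 2) * (1 + x) ^ ((1 : ℝ) / 2) : ℝ) : ℂ) *
          chebJC (1 / 2) t u / ((x : ℂ) - u) =
        ∫ x in (-1 : ℝ)..1, ((chebJ (-(1 / 2)) s x * (1 + x) * √(1 - x ^ 2)⁻¹ : ℝ) : ℂ) *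
          (chebJC (1 / 2) t u / ((x : ℂ) - u)) := by
      refine intervalIntegral.integral_congr fun x hx => ?_
      rw [Set.uIcc_of_le (by norm_num)] at hx
      rw [mul_assoc (chebJ _ _ _), rpow_neg_half_mul_rpow_half hx, mul_div_assoc, mul_assoc]
    simp_rw [h]
    rw [circleIntegral_weighted_cauchy (H := chebJ (1 / 2) t) (1 / (π : ℂ)) (by fun_prop)
      (differentiable_chebJC _ t).continuous.continuousOn]
    · have hm (x : ℝ) : chebJ (-(1 / 2)) s x * (1 + x) * chebJ (1 / 2) t x =
          chebJ (-(1 / 2)) s x * chebJ (1 / 2) t x * (1 + x) := mul_right_comm _ _ _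
      simp_rw [hm]
      rw [integral_chebJ_neg_one_half_mul_chebJ_one_half]
      split_ifs <;> simp [hpi]
    · intro x hx
      have hc := circleIntegral_div_sub_of_differentiable (differentiable_chebJC (1 / 2) t)
        (ofReal_mem_ball_zero_two (Set.Ioo_subset_Icc_self hx))
      simp_rw [← neg_sub _ (x : ℂ), div_neg]
      rw [ofReal_chebJ, neg_mul, ← hc, ← neg_one_mul, ← circleIntegral.integral_const_mul]
      simp
  · have h (u : ℂ) : ∫ x in (-1 : ℝ)..1,
        ((chebJ (1 / 2) s x * (1 - x) ^ ((1 : ℝ) / 2) * (1 + x) ^ ((1 : ℝ) / 2) : ℝ) : ℂ) *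
          chebJC (-(1 / 2)) t u / (((x : ℂ) - u) * (u - 1)) =
        ∫ x in (-1 : ℝ)..1, ((chebJ (1 / 2) s x * (1 - x ^ 2) * √(1 - x ^ 2)⁻¹ : ℝ) : ℂ) *
          (chebJC (-(1 / 2)) t u / (u - 1) / ((x : ℂ) - u)) := by
      refine intervalIntegral.integral_congr fun x hx => ?_
      rw [Set.uIcc_of_le (by norm_num)] at hx
      rw [mul_assoc (chebJ _ _ _), rpow_half_mul_rpow_half hx, mul_div_assoc, mul_assoc, div_div,
        mul_comm (u - 1)]
    have hd := differentiable_chebJC (-(1 / 2)) t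
    simp_rw [h]
    rw [circleIntegral_weighted_cauchy (F := fun u => chebJC (-(1 / 2)) t u / (u - 1))
      (H := fun x => 2 * ∑ k ∈ Finset.range t, chebJ (1 / 2) k x) (2 / (π : ℂ)) (by fun_prop)]
    · have hm (x : ℝ) : chebJ (1 / 2) s x * (1 - x ^ 2) *
          (2 * ∑ k ∈ Finset.range t, chebJ (1 / 2) k x) =
          chebJ (1 / 2) s x * (2 * ∑ k ∈ Finset.range t, chebJ (1 / 2) k x) * (1 - x ^ 2) :=
        mul_right_comm _ _ _
      simp_rw [hm]
      rw [integral_chebJ_one_half_mul_sum]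
      split_ifs <;> simp [hpi]
    · refine hd.continuous.continuousOn.div (by fun_prop) fun u hu => ?_
      rw [sub_ne_zero]
      rintro rfl
      norm_num at hu
    · intro x hx
      have hx1 : (x : ℂ) ≠ ((1 : ℝ) : ℂ) := Complex.ofReal_injective.ne hx.2.ne
      have hc := circleIntegral_div_sub_mul_sub hd
        (ofReal_mem_ball_zero_two (Set.Ioo_subset_Icc_self hx))
        (ofReal_mem_ball_zero_two (x := 1) (by norm_num)) hx1
      have hq : (chebJ (-(1 / 2)) t x - chebJ (-(1 / 2)) t 1) / (x - 1) =
          2 * ∑ k ∈ Finset.range t, chebJ (1 / 2) k x := by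
        have := sub_ne_zero.mpr hx.2.ne
        rw [chebJ_neg_one_half_eq_one_add_sum t x, chebJ_neg_one_half_eq_one_add_sum t 1]
        field_simp
        ring
      rw [← ofReal_chebJ, ← ofReal_chebJ, ← Complex.ofReal_sub, ← Complex.ofReal_sub,
        ← Complex.ofReal_div, hq, Complex.ofReal_one] at hc
      exact hc
end

section
/- Integral of the harmonic weight over an interlacing slice: fix k ≥ 1 and define h_k(u) := ∏_{1≤i<j≤r_k}(u_i² − u_j²)·∏_{i=1}^{r_k} u_i if k is even, and h_k(u) := ∏_{1≤i<j≤r_k}(u_i² − u_j²) if k is odd. Then for every v ∈ W^{k+1}, ∫_{{u ∈ W^k : u ≺ v}} h_k(u) du = h_{k+1}(v)/k!!, where k!! denotes the double factorial. -/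
open MeasureTheory Real

/-- `r_n = ⌊(n+1)/2⌋`. -/
def rr (n : ℕ) : ℕ := (n + 1) / 2

/-- The chamber `W^k`: strictly decreasing vectors, positive if `k` even and
nonnegative if `k` odd. -/
def Wk (k : ℕ) : Set (Fin (rr k) → ℝ) :=
  {u | (∀ i j : Fin (rr k), i < j → u j < u i) ∧
       (if Even k then ∀ i, 0 < u i else ∀ i, 0 ≤ u i)}

/-- Interlacement `u ≺ v` for real vectors. -/
def interlaceR {r R : ℕ} (u : Fin r → ℝ) (v : Fin R → ℝ) : Prop :=
  (∀ i : Fin r, ∀ h : (i : ℕ) < R, u i ≤ v ⟨i, h⟩) ∧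
  (∀ i : Fin r, ∀ h : (i : ℕ) + 1 < R, v ⟨(i : ℕ) + 1, h⟩ ≤ u i)

/-- The harmonic weight `h_k(u) = ∏_{i<j}(u_i² − u_j²)·(∏_i u_i if k even)`. -/
noncomputable def hWeight (k : ℕ) (u : Fin (rr k) → ℝ) : ℝ :=
  (∏ i : Fin (rr k), ∏ j ∈ Finset.Ioi i, (u i ^ 2 - u j ^ 2)) *
    (if Even k then ∏ i : Fin (rr k), u i else 1)

/-- Integrating a determinant whose rows depend on separate variables. -/
lemma integral_det_eq_det_integral {ι : Type*} [Fintype ι] [DecidableEq ι]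
    (μ : ι → Measure ℝ) [∀ i, SigmaFinite (μ i)] (f : ι → ℝ → ℝ)
    (hf : ∀ i j, Integrable (f j) (μ i)) :
    ∫ u, (Matrix.of fun i j => f j (u i)).det ∂(Measure.pi μ) =
      (Matrix.of fun i j => ∫ x, f j x ∂(μ i)).det := by
  rw [← Matrix.det_transpose (Matrix.of fun i j => ∫ x, f j x ∂(μ i)), Matrix.det_apply']
  have hdet (u : ι → ℝ) : (Matrix.of fun i j => f j (u i)).det =
      ∑ σ : Equiv.Perm ι, ((Equiv.Perm.sign σ : ℤ) : ℝ) * ∏ i, f (σ i) (u i) := by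
    rw [← Matrix.det_transpose, Matrix.det_apply']
    rfl
  simp_rw [hdet]
  rw [integral_finsetSum _ fun σ _ =>
    (Integrable.fintype_prod fun i => hf i (σ i)).const_mul _]
  refine Finset.sum_congr rfl fun σ _ => ?_
  rw [integral_const_mul, integral_fintype_prod_eq_prod (fun i => f (σ i))]
  rfl

/-- Subtracting from each row of a square matrix the next one preserves the determinant. -/
lemma det_sub_next_row {R : Type*} [CommRing R] {n : ℕ} (G : Matrix (Fin n) (Fin n) R) :
    (Matrix.of fun i j => G i j - if h : (i : ℕ) + 1 < n then G ⟨i + 1, h⟩ j else 0).det =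
      G.det := by
  let D : Matrix (Fin n) (Fin n) R := Matrix.of fun i l =>
    (if i = l then 1 else 0) - if (l : ℕ) = i + 1 then 1 else 0
  have hD : D.det = 1 := by
    rw [Matrix.det_of_isUpperTriangular]
    · simp [D]
    · intro i l hil
      have : (l : ℕ) < i := hil
      have h1 : i ≠ l := by rintro rfl; omega
      have h2 : (l : ℕ) ≠ i + 1 := by omega
      simp [D, h1, h2]
  have hDG : D * G = Matrix.of fun i j =>
      G i j - if h : (i : ℕ) + 1 < n then G ⟨i + 1, h⟩ j else 0 := by
    ext i j
    simp only [Matrix.mul_apply, D, Matrix.of_apply, sub_mul, Finset.sum_sub_distrib, ite_mul,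
      one_mul, zero_mul, Finset.sum_ite_eq, Finset.mem_univ, if_true]
    congr 1
    split_ifs with h
    · have (l : Fin n) : (l : ℕ) = i + 1 ↔ l = ⟨i + 1, h⟩ := by simp [Fin.ext_iff]
      simp [this]
    · exact Finset.sum_eq_zero fun l _ => if_neg (by omega)
  rw [← hDG, Matrix.det_mul, hD, one_mul]

/-- The product of the differences `x i - x j`, `i < j`, as a determinant. -/
lemma prod_Ioi_sub_eq_det {n : ℕ} (x : Fin n → ℝ) :
    ∏ i, ∏ j ∈ Finset.Ioi i, (x i - x j) =
      (Matrix.of fun i j : Fin n => (-1) ^ (j : ℕ) * x i ^ (j : ℕ)).det := by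
  have h := Matrix.det_vandermonde fun i => -x i
  simp only [neg_sub_neg] at h
  rw [← h]
  congr 1
  ext i j
  simp [Matrix.vandermonde_apply, neg_pow (x i)]

/-- The harmonic weight as a determinant, with a weight `x i ^ e` in each row. -/
lemma prod_Ioi_sq_sub_sq_mul_prod {n : ℕ} (x : Fin n → ℝ) (e : ℕ) :
    (∏ i, ∏ j ∈ Finset.Ioi i, (x i ^ 2 - x j ^ 2)) * ∏ i, x i ^ e =
      (Matrix.of fun i j : Fin n => (-1) ^ (j : ℕ) * x i ^ (2 * (j : ℕ) + e)).det := by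
  rw [prod_Ioi_sub_eq_det, mul_comm, ← Matrix.det_mul_column]
  congr 1
  ext i j
  simp only [Matrix.of_apply]
  ring

/-- The integral of the harmonic weight over a set which is a box up to its boundary. -/
lemma setIntegral_box_prod_sq_sub_sq {n : ℕ} (e : ℕ) (a b : Fin n → ℝ) (hab : a ≤ b)
    {S : Set (Fin n → ℝ)} (hS : (Set.univ.pi fun i => Set.Ioo (a i) (b i)) ⊆ S)
    (hS' : S ⊆ Set.Icc a b) :
    ∫ u in S, (∏ i, ∏ j ∈ Finset.Ioi i, (u i ^ 2 - u j ^ 2)) * ∏ i, u i ^ e =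
      (∏ j : Fin n, ((2 * (j : ℕ) + e + 1 : ℕ) : ℝ))⁻¹ *
        (Matrix.of fun i j : Fin n => (-1) ^ (j : ℕ) *
          (b i ^ (2 * (j : ℕ) + e + 1) - a i ^ (2 * (j : ℕ) + e + 1))).det := by
  have hbox : S =ᵐ[volume] Set.univ.pi fun i => Set.Icc (a i) (b i) := by
    rw [Set.pi_univ_Icc]
    refine hS'.eventuallyLE.antisymm ?_
    exact (Measure.univ_pi_Ioo_ae_eq_Icc (f := a) (g := b)).symm.le.trans hS.eventuallyLE
  simp_rw [prod_Ioi_sq_sub_sq_mul_prod]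
  rw [setIntegral_congr_set hbox, volume_pi, Measure.restrict_pi_pi,
    integral_det_eq_det_integral _ fun (j : Fin n) x => (-1) ^ (j : ℕ) * x ^ (2 * (j : ℕ) + e),
    ← Finset.prod_inv_distrib, ← Matrix.det_mul_row]
  · congr 1
    ext i j
    simp only [Matrix.of_apply]
    rw [integral_const_mul, integral_Icc_eq_integral_Ioc,
      ← intervalIntegral.integral_of_le (hab i), integral_pow]
    push_cast
    ring
  · intro i j
    exact (Continuous.continuousOn (by fun_prop)).integrableOn_Icc

lemma integral_slice_even {r R : ℕ} (hR : R = r + 1) (v : Fin R → ℝ)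
    (hv : ∀ i j, i < j → v j < v i) (hv0 : ∀ i, 0 ≤ v i) :
    ∫ u in {u : Fin r → ℝ | ((∀ i j, i < j → u j < u i) ∧ ∀ i, 0 < u i) ∧ interlaceR u v},
      (∏ i, ∏ j ∈ Finset.Ioi i, (u i ^ 2 - u j ^ 2)) * ∏ i, u i =
      (∏ i, ∏ j ∈ Finset.Ioi i, (v i ^ 2 - v j ^ 2)) / (2 * r).doubleFactorial := by
  subst hR
  have hanti : StrictAnti v := hv
  have key := setIntegral_box_prod_sq_sub_sq 1 (fun i : Fin r => v i.succ)
    (fun i => v i.castSucc) (fun i => (hanti i.castSucc_lt_succ).le)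
    (S := {u | ((∀ i j, i < j → u j < u i) ∧ ∀ i, 0 < u i) ∧ interlaceR u v}) ?_ ?_
  · simp only [pow_one] at key
    have hprod : (∏ j : Fin r, ((2 * (j : ℕ) + 1 + 1 : ℕ) : ℝ)) = (2 * r).doubleFactorial := by
      rw [Nat.doubleFactorial_eq_prod_even, ← Fin.prod_univ_eq_prod_range]
      push_cast
      exact Finset.prod_congr rfl fun j _ => by ring
    rw [key, hprod, inv_mul_eq_div]
    congr 1
    rw [prod_Ioi_sub_eq_det (fun i => v i ^ 2),
      ← det_sub_next_row (.of fun i j : Fin (r + 1) => (-1) ^ (j : ℕ) * (v i ^ 2) ^ (j : ℕ)),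
      Matrix.det_succ_column_zero, Finset.sum_eq_single (Fin.last r)]
    · have hneg : (-1 : ℝ) ^ r = ∏ _j : Fin r, (-1 : ℝ) := by simp
      simp only [Fin.val_last, Matrix.of_apply, lt_irrefl, dite_false, Fin.val_zero, pow_zero,
        mul_one, sub_zero]
      rw [hneg, ← Matrix.det_mul_row]
      congr 1
      ext i j
      have hi : (i : ℕ) + 1 < r + 1 := by omega
      have hs : (⟨(i : ℕ) + 1, hi⟩ : Fin (r + 1)) = i.succ := rfl
      simp only [Matrix.of_apply, Matrix.submatrix_apply, Fin.succAbove_last, Fin.val_castSucc,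
        Fin.val_succ, hi, dite_true, hs]
      ring
    · intro i _ hi
      simp [Fin.val_lt_last hi]
    · simp
  · intro u hu
    simp only [Set.mem_univ_pi, Set.mem_Ioo] at hu
    refine ⟨⟨fun i j hij => ?_, fun i => (hv0 _).trans_lt (hu i).1⟩,
      fun i h => (hu i).2.le, fun i h => (hu i).1.le⟩
    refine (hu j).2.trans_le (le_trans (hanti.antitone ?_) (hu i).1.le)
    rw [Fin.le_def]
    simpa using hij
  · rintro u ⟨-, h1, h2⟩
    exact ⟨fun i => h2 i (by omega), fun i => h1 i (by omega)⟩

lemma integral_slice_odd {r R : ℕ} (hR : R = r) (hr : 0 < r) (v : Fin R → ℝ)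
    (hv : ∀ i j, i < j → v j < v i) (hv0 : ∀ i, 0 < v i) :
    ∫ u in {u : Fin r → ℝ | ((∀ i j, i < j → u j < u i) ∧ ∀ i, 0 ≤ u i) ∧ interlaceR u v},
      ∏ i, ∏ j ∈ Finset.Ioi i, (u i ^ 2 - u j ^ 2) =
      (∏ i, ∏ j ∈ Finset.Ioi i, (v i ^ 2 - v j ^ 2)) * (∏ i, v i) /
        (2 * r - 1).doubleFactorial := by
  subst hR
  have hanti : StrictAnti v := hv
  let a : Fin R → ℝ := fun i => if h : (i : ℕ) + 1 < R then v ⟨i + 1, h⟩ else 0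
  have ha0 (i : Fin R) : 0 ≤ a i := by
    dsimp only [a]
    split_ifs
    exacts [(hv0 _).le, le_rfl]
  have key := setIntegral_box_prod_sq_sub_sq 0 a v ?_
    (S := {u | ((∀ i j, i < j → u j < u i) ∧ ∀ i, 0 ≤ u i) ∧ interlaceR u v}) ?_ ?_
  · simp only [pow_zero, Finset.prod_const_one, mul_one, add_zero] at key
    have hprod : (∏ j : Fin R, ((2 * (j : ℕ) + 1 : ℕ) : ℝ)) = (2 * R - 1).doubleFactorial := by
      obtain ⟨m, rfl⟩ := Nat.exists_eq_succ_of_ne_zero hr.ne'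
      rw [show 2 * m.succ - 1 = 2 * m + 1 by omega, Nat.doubleFactorial_eq_prod_odd,
        Fin.prod_univ_succ, ← Fin.prod_univ_eq_prod_range]
      simp
    have hv1 := prod_Ioi_sq_sub_sq_mul_prod v 1
    simp only [pow_one] at hv1
    rw [key, hprod, inv_mul_eq_div, hv1,
      ← det_sub_next_row (.of fun i j : Fin R => (-1) ^ (j : ℕ) * v i ^ (2 * (j : ℕ) + 1))]
    congr 2
    ext i j
    simp only [Matrix.of_apply, a]
    split_ifs
    · ring
    · simp
  · intro i
    dsimp only [a]
    split_ifs with h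
    · exact hanti.antitone (by rw [Fin.le_def]; simp)
    · exact (hv0 i).le
  · intro u hu
    simp only [Set.mem_univ_pi, Set.mem_Ioo] at hu
    have hlow (i : Fin R) (h : (i : ℕ) + 1 < R) : v ⟨i + 1, h⟩ < u i := by
      simpa only [a, h, dite_true] using (hu i).1
    refine ⟨⟨fun i j hij => ?_, fun i => (ha0 i).trans (hu i).1.le⟩,
      fun i h => (hu i).2.le, fun i h => (hlow i h).le⟩
    have hij' : (i : ℕ) < j := hij
    refine (hu j).2.trans_le (le_trans (hanti.antitone ?_) (hlow i (by omega)).le)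
    rw [Fin.le_def]
    simpa using hij'
  · rintro u ⟨⟨-, h0⟩, h1, h2⟩
    refine ⟨fun i => ?_, fun i => h1 i i.2⟩
    dsimp only [a]
    split_ifs with h
    exacts [h2 i h, h0 i]

/-- Integral of the harmonic weight over an interlacing slice:
`∫_{{u ∈ W^k : u ≺ v}} h_k(u) du = h_{k+1}(v)/k‼`. -/
theorem integral_harmonic_weight (k : ℕ) (hk : 1 ≤ k)
    (v : Fin (rr (k + 1)) → ℝ) (hv : v ∈ Wk (k + 1)) :
    (∫ u in {u : Fin (rr k) → ℝ | u ∈ Wk k ∧ interlaceR u v}, hWeight k u) =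
      hWeight (k + 1) v / (Nat.doubleFactorial k : ℝ) := by
  rcases Nat.even_or_odd k with hev | hodd
  · have hev' : ¬ Even (k + 1) := by simpa [Nat.even_add_one] using hev
    simp only [Wk, hev', if_false, Set.mem_ofPred_eq] at hv
    have hk2 : k = 2 * rr k := by
      obtain ⟨m, rfl⟩ := hev
      simp only [rr]
      omega
    have h := integral_slice_even (r := rr k) (by simp only [rr] at *; omega) v hv.1 hv.2
    rw [← hk2] at h
    simpa only [Wk, hWeight, hev, hev', if_true, if_false, mul_one, Set.mem_ofPred_eq] using h
  · have hev : ¬ Even k := by simpa using hodd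
    have hev' : Even (k + 1) := hodd.add_one
    simp only [Wk, hev', if_true, Set.mem_ofPred_eq] at hv
    have hk2 : 2 * rr k - 1 = k := by
      obtain ⟨m, rfl⟩ := hodd
      simp only [rr]
      omega
    have h := integral_slice_odd (r := rr k) (by simp only [rr] at *; omega)
      (by simp only [rr]; omega) v hv.1 hv.2
    rw [hk2] at h
    simpa only [Wk, hWeight, hev, hev', if_true, if_false, mul_one, Set.mem_ofPred_eq] using h
end

section
/- Edge asymptotics of Chebyshev polynomials near −1: let α ∈ {1/2, −1/2}, let x′ > 0 and ν > 0 be reals, and let (s_N)_{N≥1} be a sequence of nonnegative integers with s_N·N^{−1/4} → ν as N → ∞. Then lim_{N→∞} N^{−1/4}·(−1)^{s_N}·J_{s_N,α}(N^{−1/2}·x′ − 1) = sin(ν·√(2x′)) / (2^α·√(x′)). -/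
open Filter Real

theorem chebJ_half_neg_cos_two_mul (θ : ℝ) (n : ℕ) :
    chebJ (1 / 2) n (-cos (2 * θ)) * (2 * sin θ * cos θ) =
      (-1) ^ n * sin (2 * (n * θ + θ)) := by
  induction n using Nat.twoStepInduction with
  | zero => simp [chebJ, sin_two_mul]
  | one =>
    have h : (2 : ℝ) * (((1 : ℕ) : ℝ) * θ + θ) = 2 * (2 * θ) := by push_cast; ring
    rw [h, sin_two_mul (2 * θ), sin_two_mul θ]
    simp only [chebJ, if_true]
    ring
  | more n h0 h1 =>
    have e0 : 2 * ((n : ℝ) * θ + θ) = 2 * (((n + 1 : ℕ) : ℝ) * θ + θ) - 2 * θ := by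
      push_cast; ring
    have e2 : 2 * (((n + 2 : ℕ) : ℝ) * θ + θ) = 2 * (((n + 1 : ℕ) : ℝ) * θ + θ) + 2 * θ := by
      push_cast; ring
    rw [e0, sin_sub] at h0
    rw [e2, sin_add]
    simp only [chebJ]
    linear_combination (-2 * cos (2 * θ)) * h1 - h0

theorem chebJ_neg_half_neg_cos_two_mul (θ : ℝ) (n : ℕ) :
    chebJ (-(1 / 2)) n (-cos (2 * θ)) * sin θ = (-1) ^ n * sin (2 * (n * θ) + θ) := by
  induction n using Nat.twoStepInduction with
  | zero => simp [chebJ]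
  | one =>
    have h : ¬ (-(1 / 2) : ℝ) = 1 / 2 := by norm_num
    simp only [chebJ, if_neg h, Nat.cast_one, one_mul]
    rw [sin_add, sin_two_mul, cos_two_mul]
    ring
  | more n h0 h1 =>
    have e0 : 2 * ((n : ℝ) * θ) + θ = 2 * (((n + 1 : ℕ) : ℝ) * θ) + θ - 2 * θ := by
      push_cast; ring
    have e2 : 2 * (((n + 2 : ℕ) : ℝ) * θ) + θ = 2 * (((n + 1 : ℕ) : ℝ) * θ) + θ + 2 * θ := by
      push_cast; ring
    rw [e0, sin_sub] at h0
    rw [e2, sin_add]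
    simp only [chebJ]
    linear_combination (-2 * cos (2 * θ)) * h1 - h0

theorem tendsto_arcsin_mul_div {ι : Type*} {l : Filter ι} {a : ι → ℝ} (c : ℝ)
    (ha : Tendsto a l (nhds 0)) (ha0 : ∀ᶠ i in l, a i ≠ 0) :
    Tendsto (fun i => arcsin (a i * c) / a i) l (nhds c) := by
  have hd : HasDerivAt (fun t : ℝ => arcsin (t * c)) c 0 := by
    have h0 : HasDerivAt arcsin 1 ((0 : ℝ) * c) := by
      simpa using hasDerivAt_arcsin (x := 0) (by norm_num) (by norm_num)
    simpa [Function.comp_def] using h0.comp (0 : ℝ) ((hasDerivAt_id (0 : ℝ)).mul_const c)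
  have h := hd.tendsto_slope.comp (tendsto_nhdsWithin_iff.2 ⟨ha, ha0⟩)
  refine h.congr fun i => ?_
  simp [slope_def_field]

/-- Edge asymptotics of Chebyshev polynomials near `−1`:
`N^{−1/4}·(−1)^{s_N}·J_{s_N,α}(N^{−1/2}x′ − 1) → sin(ν√(2x′))/(2^α √x′)`
whenever `s_N·N^{−1/4} → ν`. -/
theorem chebJ_edge_asymptotics (α : ℝ) (hα : α = 1 / 2 ∨ α = -(1 / 2))
    (x' ν : ℝ) (hx : 0 < x') (hν : 0 < ν) (s : ℕ → ℕ)
    (hs : Tendsto (fun N : ℕ => (s N : ℝ) * (N : ℝ) ^ (-(1 : ℝ) / 4)) atTop (nhds ν)) :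
    Tendsto
      (fun N : ℕ => (N : ℝ) ^ (-(1 : ℝ) / 4) * (-1 : ℝ) ^ (s N) *
        chebJ α (s N) ((N : ℝ) ^ (-(1 : ℝ) / 2) * x' - 1))
      atTop
      (nhds (Real.sin (ν * Real.sqrt (2 * x')) / ((2 : ℝ) ^ α * Real.sqrt x'))) := by
  set a : ℕ → ℝ := fun N => (N : ℝ) ^ (-(1 : ℝ) / 4) with ha_def
  set c : ℝ := √x' / √2 with hc_def
  have hc : 0 < c := by positivity
  have h2 : √2 * √2 = (2 : ℝ) := mul_self_sqrt (by norm_num)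
  have hc_sq : 2 * c ^ 2 = x' := by
    rw [hc_def, div_pow, sq_sqrt hx.le, sq_sqrt (by norm_num)]; ring
  have hc_two : 2 * c = √2 * √x' := by
    rw [hc_def]; field_simp; linear_combination -h2
  have hsqrt : √(2 * x') = 2 * c := by rw [sqrt_mul (by norm_num), hc_two]
  have ha : Tendsto a atTop (nhds 0) := by
    have h := (tendsto_rpow_neg_atTop (y := (1 / 4 : ℝ)) (by norm_num)).comp
      (tendsto_natCast_atTop_atTop (R := ℝ))
    refine h.congr fun N => ?_
    simp only [ha_def, Function.comp, neg_div]
  have ha_pos : ∀ᶠ N in atTop, 0 < a N := by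
    filter_upwards [eventually_gt_atTop 0] with N hN
    exact rpow_pos_of_pos (by exact_mod_cast hN) _
  set θ : ℕ → ℝ := fun N => arcsin (a N * c) with hθ_def
  have hac : Tendsto (fun N => a N * c) atTop (nhds 0) := by simpa using ha.mul_const c
  have hθ : Tendsto θ atTop (nhds 0) := by
    simpa [Function.comp_def, hθ_def] using (continuous_arcsin.tendsto 0).comp hac
  have hsθ : Tendsto (fun N => (s N : ℝ) * θ N) atTop (nhds (ν * c)) := by
    refine (hs.mul (tendsto_arcsin_mul_div c ha (ha_pos.mono fun _ h => h.ne'))).congr' ?_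
    filter_upwards [ha_pos] with N hN
    change (s N : ℝ) * a N * (θ N / a N) = _
    field_simp
  have hsin : ∀ᶠ N in atTop, sin (θ N) = a N * c := by
    filter_upwards [ha_pos, hac.eventually_le_const one_pos] with N hN hN1
    exact sin_arcsin (by nlinarith [mul_pos hN hc]) hN1
  have hcos : Tendsto (fun N => cos (θ N)) atTop (nhds 1) := by
    simpa [Function.comp_def] using (continuous_cos.tendsto 0).comp hθ
  have harg : ∀ᶠ N : ℕ in atTop, (N : ℝ) ^ (-(1 : ℝ) / 2) * x' - 1 = -cos (2 * θ N) := by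
    filter_upwards [hsin] with N hN
    have hsq : (N : ℝ) ^ (-(1 : ℝ) / 2) = a N ^ 2 := by
      rw [ha_def, ← rpow_mul_natCast N.cast_nonneg]; norm_num
    rw [hsq, cos_two_mul, cos_sq', hN]
    linear_combination -a N ^ 2 * hc_sq
  have hsign : ∀ n : ℕ, (-1 : ℝ) ^ n * (-1) ^ n = 1 := fun n => by
    rw [← mul_pow]; norm_num
  rcases hα with rfl | rfl
  · have hlim : Tendsto (fun N => sin (2 * (s N * θ N + θ N)) / (2 * c * cos (θ N))) atTop
        (nhds (sin (2 * (ν * c + 0)) / (2 * c * 1))) :=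
      ((continuous_sin.tendsto _).comp ((hsθ.add hθ).const_mul 2)).div
        (hcos.const_mul (2 * c)) (by positivity)
    have hval : sin (2 * (ν * c + 0)) / (2 * c * 1) =
        sin (ν * √(2 * x')) / ((2 : ℝ) ^ (1 / 2 : ℝ) * √x') := by
      rw [hsqrt, ← sqrt_eq_rpow, ← hc_two]
      ring_nf
    rw [← hval]
    refine hlim.congr' ?_
    filter_upwards [harg, hsin, hcos.eventually_const_lt one_pos] with N h1 hN hpos
    have key := chebJ_half_neg_cos_two_mul (θ N) (s N)
    rw [h1, div_eq_iff (by positivity)]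
    rw [hN] at key
    linear_combination (-(-1) ^ s N) * key - sin (2 * (s N * θ N + θ N)) * hsign (s N)
  · have hlim : Tendsto (fun N => sin (2 * (s N * θ N) + θ N) / c) atTop
        (nhds (sin (2 * (ν * c) + 0) / c)) :=
      ((continuous_sin.tendsto _).comp ((hsθ.const_mul 2).add hθ)).div_const c
    have hval : sin (2 * (ν * c) + 0) / c =
        sin (ν * √(2 * x')) / ((2 : ℝ) ^ (-(1 / 2) : ℝ) * √x') := by
      rw [hsqrt, rpow_neg (by norm_num), ← sqrt_eq_rpow, inv_mul_eq_div, ← hc_def]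
      congr 2; ring
    rw [← hval]
    refine hlim.congr' ?_
    filter_upwards [harg, hsin] with N h1 hN
    have key := chebJ_neg_half_neg_cos_two_mul (θ N) (s N)
    rw [h1, div_eq_iff hc.ne']
    rw [hN] at key
    linear_combination (-(-1) ^ s N) * key - sin (2 * (s N * θ N) + θ N) * hsign (s N)
end
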